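/- Let (l, k, b) be a suspension triplet for (X_A, σ_A). For every (x, r) ∈ X_{A,b}^ℝ with r ≥ l(x), there exists (z, s) ∈ X_{A,b}^ℝ with b(z) ≤ s < l(z) such that (x, r) ∼_{l,k} (z, s). -/

import Mathlib

open scoped BigOperators NNReal

namespace OneSidedMarkov

variable {N M : ℕ}

/-- The matrix has entries in `{0, 1}`. -/
def IsZeroOne (A : Matrix (Fin N) (Fin N) ℤ) : Prop := ∀ i j, A i j = 0 ∨ A i j = 1

/-- The matrix is irreducible. -/
def IsIrreducible (A : Matrix (Fin N) (Fin N) ℤ) : Prop :=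
  ∀ i j, ∃ m : ℕ, 0 < m ∧ (A ^ m) i j ≠ 0

/-- The matrix is a permutation matrix. -/
def IsPermutationMatrix (A : Matrix (Fin N) (Fin N) ℤ) : Prop :=
  ∃ e : Equiv.Perm (Fin N), ∀ i j, A i j = if e i = j then 1 else 0

/-- The one-sided topological Markov shift space `X_A`. -/
abbrev Space (A : Matrix (Fin N) (Fin N) ℤ) : Type :=
  {x : ℕ → Fin N // ∀ n, A (x n) (x (n + 1)) = 1}

/-- The shift map `σ_A`. -/
def shift (A : Matrix (Fin N) (Fin N) ℤ) (x : Space A) : Space A :=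
  ⟨fun n => x.1 (n + 1), fun n => x.2 (n + 1)⟩

lemma continuous_shift (A : Matrix (Fin N) (Fin N) ℤ) : Continuous (shift A) := by
  apply Continuous.subtype_mk
  exact continuous_pi fun n => (continuous_apply (n + 1)).comp continuous_subtype_val

/-- The shift map as a continuous map. -/
def shiftMap (A : Matrix (Fin N) (Fin N) ℤ) : C(Space A, Space A) :=
  ⟨shift A, continuous_shift A⟩

/-- The coboundary subgroup `{ g - g ∘ σ_A }` of `C(X_A, ℤ)`. -/
def cobdySubgroup (A : Matrix (Fin N) (Fin N) ℤ) : AddSubgroup C(Space A, ℤ) :=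
  AddSubgroup.closure {f | ∃ g : C(Space A, ℤ), f = g - g.comp (shiftMap A)}

/-- The ordered cohomology group `H^A = C(X_A, ℤ)/{g - g∘σ_A}`. -/
abbrev Coh (A : Matrix (Fin N) (Fin N) ℤ) : Type :=
  C(Space A, ℤ) ⧸ cobdySubgroup A

/-- The class `[f] ∈ H^A`. -/
def cohClass (A : Matrix (Fin N) (Fin N) ℤ) (f : C(Space A, ℤ)) : Coh A :=
  QuotientAddGroup.mk f

/-- The positive cone `H^A_+`. -/
def CohPos (A : Matrix (Fin N) (Fin N) ℤ) : Set (Coh A) :=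
  {c | ∃ f : C(Space A, ℤ), (∀ x, 0 ≤ f x) ∧ c = cohClass A f}

/-- `u` is an order unit of `(H^A, H^A_+)`. -/
def IsOrderUnit (A : Matrix (Fin N) (Fin N) ℤ) (u : Coh A) : Prop :=
  u ∈ CohPos A ∧ ∀ g : Coh A, ∃ n : ℕ, 0 < n ∧ n • u - g ∈ CohPos A

/-- The data `(l, k, b)` of a suspension. -/
structure SuspData (A : Matrix (Fin N) (Fin N) ℤ) where
  l : C(Space A, ℝ)
  k : C(Space A, ℝ)
  b : C(Space A, ℝ)

/-- `c = l - k`. -/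
def cFun {A : Matrix (Fin N) (Fin N) ℤ} (T : SuspData A) (x : Space A) : ℝ :=
  T.l x - T.k x

/-- `(l, k, b)` is a suspension triplet for `(X_A, σ_A)`. -/
def IsSuspTriplet {A : Matrix (Fin N) (Fin N) ℤ} (T : SuspData A) : Prop :=
  (∀ x, 0 ≤ T.l x) ∧ (∀ x, 0 ≤ T.k x) ∧
  (∃ c : C(Space A, ℤ), (∀ x, (c x : ℝ) = cFun T x) ∧ IsOrderUnit A (cohClass A c)) ∧
  (∀ x, ∃ m : ℕ, T.l x - T.b x = m) ∧
  (∀ x, ∃ m : ℕ, T.k x - T.b (shift A x) = m)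

/-- The space `X_{A,b}^ℝ = {(x, r) : r ≥ b(x)}`. -/
abbrev BaseSpace {A : Matrix (Fin N) (Fin N) ℤ} (T : SuspData A) : Type :=
  {p : Space A × ℝ // T.b p.1 ≤ p.2}

/-- The elementary relation `(x, r) ∼ (σ_A(x), r - c(x))` for `r ≥ l(x)`. -/
def SuspRel {A : Matrix (Fin N) (Fin N) ℤ} (T : SuspData A)
    (p q : BaseSpace T) : Prop :=
  T.l p.1.1 ≤ p.1.2 ∧ q.1 = (shift A p.1.1, p.1.2 - cFun T p.1.1)

/-- The equivalence relation `∼_{l,k}` generated by `SuspRel`. -/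
def suspSetoid {A : Matrix (Fin N) (Fin N) ℤ} (T : SuspData A) : Setoid (BaseSpace T) :=
  ⟨Relation.EqvGen (SuspRel T), Relation.EqvGen.is_equivalence _⟩

/-- The one-sided suspension `S_{A,b}^{l,k}` with the quotient topology. -/
abbrev Susp {A : Matrix (Fin N) (Fin N) ℤ} (T : SuspData A) : Type :=
  Quotient (suspSetoid T)

/-- The class `[x, r]`. -/
def mkSusp {A : Matrix (Fin N) (Fin N) ℤ} (T : SuspData A) (p : BaseSpace T) : Susp T :=
  Quotient.mk (suspSetoid T) p

/-- The base map `x ↦ [x, b(x)]`. -/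
def basePoint {A : Matrix (Fin N) (Fin N) ℤ} (T : SuspData A) (x : Space A) : Susp T :=
  mkSusp T ⟨(x, T.b x), le_refl _⟩

/-- Translation by `t ≥ 0` on `X_{A,b}^ℝ`. -/
def shiftPt {A : Matrix (Fin N) (Fin N) ℤ} (T : SuspData A) (t : ℝ≥0)
    (p : BaseSpace T) : BaseSpace T :=
  ⟨(p.1.1, p.1.2 + t), le_trans p.2 (le_add_of_nonneg_right t.2)⟩

lemma suspRel_shiftPt {A : Matrix (Fin N) (Fin N) ℤ} (T : SuspData A) (t : ℝ≥0)
    {p q : BaseSpace T} (h : SuspRel T p q) : SuspRel T (shiftPt T t p) (shiftPt T t q) := by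
  obtain ⟨h1, h2⟩ := h
  refine ⟨le_trans h1 (le_add_of_nonneg_right t.2), ?_⟩
  show (q.1.1, q.1.2 + (t : ℝ)) = _
  rw [h2]
  show (shift A p.1.1, p.1.2 - cFun T p.1.1 + (t : ℝ))
      = (shift A p.1.1, p.1.2 + (t : ℝ) - cFun T p.1.1)
  congr 1
  ring

lemma eqvGen_map {α : Type*} {r r' : α → α → Prop} (f : α → α)
    (hf : ∀ a b, r a b → r' (f a) (f b)) :
    ∀ a b, Relation.EqvGen r a b → Relation.EqvGen r' (f a) (f b) := by
  intro a b h
  induction h with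
  | rel a b hab => exact Relation.EqvGen.rel _ _ (hf a b hab)
  | refl a => exact Relation.EqvGen.refl _
  | symm a b _ ih => exact Relation.EqvGen.symm _ _ ih
  | trans a b c _ _ ih1 ih2 => exact Relation.EqvGen.trans _ _ _ ih1 ih2

/-- The flow `φ_{A,t}([x, r]) = [x, r + t]`, `t ∈ ℝ_+`, on the one-sided suspension. -/
def flow {A : Matrix (Fin N) (Fin N) ℤ} (T : SuspData A) (t : ℝ≥0) :
    Susp T → Susp T :=
  Quotient.map' (shiftPt T t)
    (fun p q h => eqvGen_map (shiftPt T t) (fun _ _ hr => suspRel_shiftPt T t hr) p q h)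

/-- The standard suspension data `(1, 0, 0)`. -/
def stdData (A : Matrix (Fin N) (Fin N) ℤ) : SuspData A := ⟨1, 0, 0⟩

/-- The standard one-sided suspension `S_A^1`. -/
abbrev StdSusp (A : Matrix (Fin N) (Fin N) ℤ) : Type := Susp (stdData A)

/-- The standard base map `s_A(x) = [x, 0]`. -/
def stdBase (A : Matrix (Fin N) (Fin N) ℤ) : Space A → StdSusp A :=
  basePoint (stdData A)

/-- The orbit equations of a continuous orbit equivalence. -/
def OrbitEqFns (A : Matrix (Fin N) (Fin N) ℤ) (B : Matrix (Fin M) (Fin M) ℤ)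
    (h : Space A ≃ₜ Space B) (k1 l1 : C(Space A, ℕ)) (k2 l2 : C(Space B, ℕ)) : Prop :=
  (∀ x : Space A, (shift B)^[k1 x] (h (shift A x)) = (shift B)^[l1 x] (h x)) ∧
  (∀ y : Space B, (shift A)^[k2 y] (h.symm (shift B y)) = (shift A)^[l2 y] (h.symm y))

/-- `(X_A, σ_A)` and `(X_B, σ_B)` are continuously orbit equivalent. -/
def ContOrbitEquiv (A : Matrix (Fin N) (Fin N) ℤ) (B : Matrix (Fin M) (Fin M) ℤ) : Prop :=
  ∃ h : Space A ≃ₜ Space B, ∃ k1 l1 : C(Space A, ℕ), ∃ k2 l2 : C(Space B, ℕ),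
    OrbitEqFns A B h k1 l1 k2 l2

/-- One-sided flow equivalence via the homeomorphism `h`. -/
def FlowEquivVia (A : Matrix (Fin N) (Fin N) ℤ) (B : Matrix (Fin M) (Fin M) ℤ)
    (h : Space A ≃ₜ Space B) : Prop :=
  ∃ T₁ : SuspData A, IsSuspTriplet T₁ ∧ ∃ T₂ : SuspData B, IsSuspTriplet T₂ ∧
  ∃ Φ₁ : Susp T₁ → StdSusp B, Continuous Φ₁ ∧
  ∃ Φ₂ : Susp T₂ → StdSusp A, Continuous Φ₂ ∧
  (∀ (t : ℝ≥0) (p : Susp T₁), Φ₁ (flow T₁ t p) = flow (stdData B) t (Φ₁ p)) ∧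
  (∀ x : Space A, Φ₁ (basePoint T₁ x) = stdBase B (h x)) ∧
  (∀ (t : ℝ≥0) (q : Susp T₂), Φ₂ (flow T₂ t q) = flow (stdData A) t (Φ₂ q)) ∧
  (∀ y : Space B, Φ₂ (basePoint T₂ y) = stdBase A (h.symm y))

/-- `(X_A, σ_A)` and `(X_B, σ_B)` are one-sided flow equivalent. -/
def OneSidedFlowEquiv (A : Matrix (Fin N) (Fin N) ℤ) (B : Matrix (Fin M) (Fin M) ℤ) : Prop :=
  ∃ h : Space A ≃ₜ Space B, FlowEquivVia A B h

/-- `f^m(x) = Σ_{i<m} f(σ_A^i(x))` for integer-valued `f`. -/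
def birk (A : Matrix (Fin N) (Fin N) ℤ) (f : Space A → ℤ) (m : ℕ) (x : Space A) : ℤ :=
  ∑ i ∈ Finset.range m, f ((shift A)^[i] x)

/-- `f^m(x) = Σ_{i<m} f(σ_A^i(x))` for real-valued `f`. -/
def birkR (A : Matrix (Fin N) (Fin N) ℤ) (f : Space A → ℝ) (m : ℕ) (x : Space A) : ℝ :=
  ∑ i ∈ Finset.range m, f ((shift A)^[i] x)

/-- `f^m(x) = Σ_{i<m} f(σ_A^i(x))` for ℕ-valued `f`. -/
def birkN (A : Matrix (Fin N) (Fin N) ℤ) (f : Space A → ℕ) (m : ℕ) (x : Space A) : ℕ :=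
  ∑ i ∈ Finset.range m, f ((shift A)^[i] x)

/-- The map `Ψ_h` associated with a continuous orbit equivalence. -/
def psi (A : Matrix (Fin N) (Fin N) ℤ) (B : Matrix (Fin M) (Fin M) ℤ)
    (h : Space A → Space B) (l1 k1 : Space A → ℕ) (f : Space B → ℤ) :
    Space A → ℤ :=
  fun x => (∑ i ∈ Finset.range (l1 x), f ((shift B)^[i] (h x)))
    - ∑ j ∈ Finset.range (k1 x), f ((shift B)^[j] (h (shift A x)))

/-- The dynamical zeta function `ζ_{A,f}(s)` with potential `f`. -/
noncomputable def zeta (A : Matrix (Fin N) (Fin N) ℤ) (f : Space A → ℤ) (s : ℂ) : ℂ :=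
  Complex.exp (∑' n : ℕ, (1 / (n + 1 : ℂ)) *
    ∑' x : {x : Space A // (shift A)^[n + 1] x = x},
      Complex.exp (-s * ((birk A f (n + 1) x.1 : ℤ) : ℂ)))

/-- `γ` is a periodic orbit of `(X_A, σ_A)`. -/
def IsPerOrbit (A : Matrix (Fin N) (Fin N) ℤ) (γ : Set (Space A)) : Prop :=
  ∃ (x : Space A) (p : ℕ), 0 < p ∧ (shift A)^[p] x = x ∧
    (∀ q : ℕ, 0 < q → (shift A)^[q] x = x → p ≤ q) ∧
    γ = {y | ∃ i : ℕ, i < p ∧ y = (shift A)^[i] x}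

/-- `τ` is a primitive periodic orbit of the flow on the one-sided suspension. -/
def IsFlowOrbit {A : Matrix (Fin N) (Fin N) ℤ} (T : SuspData A) (τ : Set (Susp T)) : Prop :=
  ∃ u : Susp T, (∃ t : ℝ≥0, 0 < t ∧ flow T t u = u) ∧
    τ = Set.range (fun t : ℝ≥0 => flow T t u)

/-- `ℓ(u) = min { t > 0 : φ_{A,t}(u) = u }`. -/
noncomputable def pointLen {A : Matrix (Fin N) (Fin N) ℤ} (T : SuspData A) (u : Susp T) : ℝ≥0 :=
  sInf {t : ℝ≥0 | 0 < t ∧ flow T t u = u}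

/-- `ℓ(τ) = min { t > 0 : φ_{A,t}(u) = u for all u ∈ τ }`. -/
noncomputable def orbitLen {A : Matrix (Fin N) (Fin N) ℤ} (T : SuspData A)
    (τ : Set (Susp T)) : ℝ≥0 :=
  sInf {t : ℝ≥0 | 0 < t ∧ ∀ u ∈ τ, flow T t u = u}

instance compactSpace_space {N : ℕ} (A : Matrix (Fin N) (Fin N) ℤ) : CompactSpace (Space A) := by
  have hclosed : IsClosed {x : ℕ → Fin N | ∀ n, A (x n) (x (n + 1)) = 1} := by
    rw [Set.ofPred_forall]
    refine isClosed_iInter fun n => ?_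
    have h : Continuous fun x : ℕ → Fin N => (x n, x (n + 1)) := by fun_prop
    exact (isClosed_discrete {p : Fin N × Fin N | A p.1 p.2 = 1}).preimage h
  exact isCompact_iff_compactSpace.mp hclosed.isCompact

lemma exists_eq_sub_comp_of_mem_cobdySubgroup {N : ℕ} {A : Matrix (Fin N) (Fin N) ℤ}
    {f : C(Space A, ℤ)} (hf : f ∈ cobdySubgroup A) :
    ∃ g : C(Space A, ℤ), f = g - g.comp (shiftMap A) := by
  induction hf using AddSubgroup.closure_induction with
  | mem f hf => exact hf
  | zero => exact ⟨0, by ext; simp⟩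
  | add f₁ f₂ _ _ h₁ h₂ =>
    obtain ⟨g₁, rfl⟩ := h₁
    obtain ⟨g₂, rfl⟩ := h₂
    exact ⟨g₁ + g₂, by ext; simp; ring⟩
  | neg f _ h =>
    obtain ⟨g, rfl⟩ := h
    exact ⟨-g, by ext; simp; ring⟩

lemma exists_abs_le {X : Type*} [TopologicalSpace X] [CompactSpace X] (g : C(X, ℤ)) :
    ∃ B : ℤ, ∀ x, |g x| ≤ B := by
  obtain ⟨B, hB⟩ := (isCompact_range (continuous_abs.comp g.continuous)).bddAbove
  exact ⟨B, fun x => hB ⟨x, rfl⟩⟩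

/-- The Birkhoff sums of a function whose class is an order unit are unbounded above along
every orbit. -/
lemma IsOrderUnit.exists_lt_birkhoffSum {N : ℕ} {A : Matrix (Fin N) (Fin N) ℤ}
    {c : C(Space A, ℤ)} (hc : IsOrderUnit A (cohClass A c)) (x : Space A) (K : ℤ) :
    ∃ m : ℕ, K < birkhoffSum (shift A) c m x := by
  obtain ⟨n, hn, f, hf, hnf⟩ := hc.2 (cohClass A 1)
  have hmem : -(n • c - 1) + f ∈ cobdySubgroup A := QuotientAddGroup.eq.mp hnf
  obtain ⟨g, hg⟩ := exists_eq_sub_comp_of_mem_cobdySubgroup hmem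
  obtain ⟨B, hB⟩ := exists_abs_le g
  have hpt (y : Space A) : n * c y = 1 + f y - (g y - g (shift A y)) := by
    have h := DFunLike.congr_fun hg y
    simp only [ContinuousMap.add_apply, ContinuousMap.neg_apply, ContinuousMap.sub_apply,
      ContinuousMap.smul_apply, ContinuousMap.one_apply, ContinuousMap.comp_apply] at h
    rw [nsmul_eq_mul] at h
    change _ = g y - g (shift A y) at h
    linarith
  have hlower (m : ℕ) :
      m - g x + g ((shift A)^[m] x) ≤ n * birkhoffSum (shift A) c m x := by
    induction m with
    | zero => simp
    | succ m ih =>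
      rw [birkhoffSum_succ, mul_add, hpt, Function.iterate_succ_apply']
      have := hf ((shift A)^[m] x)
      push_cast
      linarith
  refine ⟨(n * |K| + 2 * B + 1).toNat, ?_⟩
  set m := (n * |K| + 2 * B + 1).toNat
  have hm : n * |K| + 2 * B + 1 ≤ m := Int.self_le_toNat _
  have h₁ := (abs_le.mp (hB x)).2
  have h₂ := (abs_le.mp (hB ((shift A)^[m] x))).1
  have h₃ : (n : ℤ) * |K| < n * birkhoffSum (shift A) c m x := by linarith [hlower m]
  exact (le_abs_self K).trans_lt (lt_of_mul_lt_mul_left h₃ (by positivity))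

lemma exists_rep_of_sub_birkhoffSum_lt {N : ℕ} {A : Matrix (Fin N) (Fin N) ℤ} {T : SuspData A}
    (hk : ∀ x, T.b (shift A x) ≤ T.k x) (m : ℕ) (x : Space A) (r : ℝ) (hb : T.b x ≤ r)
    (hm : r - birkhoffSum (shift A) (cFun T) m x < T.l ((shift A)^[m] x)) :
    ∃ (z : Space A) (s : ℝ) (hbz : T.b z ≤ s), s < T.l z ∧
      Relation.EqvGen (SuspRel T) ⟨(x, r), hb⟩ ⟨(z, s), hbz⟩ := by
  induction m generalizing x r with
  | zero => exact ⟨x, r, hb, by simpa using hm, .refl _⟩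
  | succ m ih =>
    rcases lt_or_ge r (T.l x) with hr | hr
    · exact ⟨x, r, hb, hr, .refl _⟩
    have hb' : T.b (shift A x) ≤ r - cFun T x := by
      have := hk x
      unfold cFun
      linarith
    rw [birkhoffSum_succ', Function.iterate_succ_apply, ← sub_sub] at hm
    obtain ⟨z, s, hbz, hs, hrel⟩ := ih (shift A x) (r - cFun T x) hb' hm
    exact ⟨z, s, hbz, hs, .trans _ _ _ (.rel _ _ ⟨hr, rfl⟩) hrel⟩

theorem exists_rep_below_ceiling
    {N : ℕ} (A : Matrix (Fin N) (Fin N) ℤ)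
    (hN : 1 < N) (hA01 : IsZeroOne A)
    (hAirr : IsIrreducible A) (hAnp : ¬ IsPermutationMatrix A)
    (T : SuspData A) (hT : IsSuspTriplet T)
    (x : Space A) (r : ℝ) (hb : T.b x ≤ r) (hl : T.l x ≤ r) :
    ∃ (z : Space A) (s : ℝ) (hbz : T.b z ≤ s), s < T.l z ∧
      Relation.EqvGen (SuspRel T) ⟨(x, r), hb⟩ ⟨(z, s), hbz⟩ := by
  obtain ⟨hl₀, -, ⟨c, hc, hunit⟩, -, hk⟩ := hT
  obtain ⟨m, hm⟩ := hunit.exists_lt_birkhoffSum x ⌈r⌉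
  have hk' (y : Space A) : T.b (shift A y) ≤ T.k y := by
    obtain ⟨j, hj⟩ := hk y
    have : (0 : ℝ) ≤ j := j.cast_nonneg
    linarith
  refine exists_rep_of_sub_birkhoffSum_lt hk' m x r hb (lt_of_lt_of_le ?_ (hl₀ _))
  have hsum : birkhoffSum (shift A) (cFun T) m x = (birkhoffSum (shift A) c m x : ℤ) := by
    simp [birkhoffSum, hc]
  rw [hsum, sub_neg]
  exact (Int.le_ceil r).trans_lt (by exact_mod_cast hm)

end OneSidedMarkov
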